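/- Let p ∈ (1, ∞) with p ≠ 2 and let θ ∈ ℝ be irrational. Write 𝕋 = ℝ/ℤ and consider the Banach space ℓ^p(𝕋 × ℤ) of p-summable functions on the set 𝕋 × ℤ. Define bounded operators on ℓ^p(𝕋 × ℤ) by (U ξ)(x, n) = ξ(x, n − 1), (U' ξ)(x, n) = ξ(x, n + 1), and, for each continuous function f : 𝕋 → ℂ, (M_f ξ)(x, n) = f(x + nθ) · ξ(x, n). Let A_θ^p be the smallest closed subalgebra of B(ℓ^p(𝕋 × ℤ)) containing U, U', and all the operators M_f; it is unital with unit the identity operator. Let B be any unital complex Banach algebra such that: (i) there exist a measure space (Ω, μ) and a unital isometric algebra homomorphism B → B(L^p(μ)); and (ii) there is an increasing sequence B_0 ⊆ B_1 ⊆ ⋯ of closed subalgebras of B whose union is dense in B, each B_j being isometrically isomorphic as a Banach algebra to a finite direct sum ⨁_{i=1}^{M_j} B(ℓ^p(Fin N_i^{(j)})) equipped with the maximum of the operator norms of the summands. Then there is no unital contractive algebra homomorphism from A_θ^p to B. -/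

import Mathlib

open scoped ENNReal

section Helpers
open MeasureTheory

theorem aux_superadd {q : ℝ} (hq : 1 < q) {s t : ℝ} (hs : 0 < s) (ht : 0 < t) :
    s ^ q + t ^ q < (s + t) ^ q := by
  have h1 : s ^ q = s * s ^ (q - 1) := by
    rw [← Real.rpow_one_add' hs.le (by linarith)]; congr 1; ring
  have h2 : t ^ q = t * t ^ (q - 1) := by
    rw [← Real.rpow_one_add' ht.le (by linarith)]; congr 1; ring
  have h3 : (s + t) ^ q = (s + t) * (s + t) ^ (q - 1) := by
    rw [← Real.rpow_one_add' (by linarith) (by linarith)]; congr 1; ring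
  have h4 : s ^ (q - 1) < (s + t) ^ (q - 1) := Real.rpow_lt_rpow hs.le (by linarith) (by linarith)
  have h5 : t ^ (q - 1) < (s + t) ^ (q - 1) := Real.rpow_lt_rpow ht.le (by linarith) (by linarith)
  rw [h1, h2, h3]
  nlinarith

theorem aux_subadd {q : ℝ} (hq0 : 0 < q) (hq : q < 1) {s t : ℝ} (hs : 0 < s) (ht : 0 < t) :
    (s + t) ^ q < s ^ q + t ^ q := by
  have h := aux_superadd (q := 1 / q) (by rw [lt_div_iff₀ hq0]; linarith)
    (Real.rpow_pos_of_pos hs q) (Real.rpow_pos_of_pos ht q)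
  rw [← Real.rpow_mul hs.le, ← Real.rpow_mul ht.le, mul_one_div_cancel hq0.ne', Real.rpow_one,
    Real.rpow_one] at h
  have h2 := Real.rpow_lt_rpow (by positivity) h hq0
  rwa [← Real.rpow_mul (by positivity), one_div_mul_cancel hq0.ne', Real.rpow_one] at h2

theorem aux_clarkson {r : ℝ} (hr0 : 0 < r) (hr2 : r ≠ 2) :
    ∃ s : ℝ, ∀ a b : ℂ, 0 ≤ s * (‖a + b‖ ^ r + ‖a - b‖ ^ r - 2 * ‖a‖ ^ r - 2 * ‖b‖ ^ r) ∧
      (s * (‖a + b‖ ^ r + ‖a - b‖ ^ r - 2 * ‖a‖ ^ r - 2 * ‖b‖ ^ r) = 0 → a = 0 ∨ b = 0) := by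
  have key : ∀ c : ℂ, ‖c‖ ^ r = (‖c‖ ^ 2) ^ (r / 2) := by
    intro c
    rw [← Real.rpow_natCast, ← Real.rpow_mul (norm_nonneg _)]; congr 1; push_cast; ring
  have para : ∀ a b : ℂ, ‖a + b‖ ^ 2 + ‖a - b‖ ^ 2 = 2 * (‖a‖ ^ 2 + ‖b‖ ^ 2) := by
    intro a b
    have := parallelogram_law_with_norm ℝ a b
    nlinarith
  have z : ∀ a b : ℂ, (a = 0 ∨ b = 0) →
      (‖a + b‖ ^ r + ‖a - b‖ ^ r - 2 * ‖a‖ ^ r - 2 * ‖b‖ ^ r) = 0 := by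
    rintro a b (rfl | rfl)
    · simp [Real.zero_rpow hr0.ne']; ring
    · simp [Real.zero_rpow hr0.ne']; ring
  rcases lt_or_gt_of_ne hr2 with h | h
  · refine ⟨-1, fun a b => ?_⟩
    by_cases hab : a = 0 ∨ b = 0
    · rw [z a b hab]; simpa using hab
    · push Not at hab
      have h1 := aux_subadd (q := r / 2) (by linarith) (by linarith)
        (s := ‖a‖ ^ 2) (t := ‖b‖ ^ 2) (by have := norm_pos_iff.2 hab.1; positivity)
        (by have := norm_pos_iff.2 hab.2; positivity)
      have h2' := (Real.concaveOn_rpow (p := r / 2) (by linarith) (by linarith)).2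
      have h2 := @h2' (‖a + b‖ ^ 2) (Set.mem_Ici.2 (by positivity)) (‖a - b‖ ^ 2)
        (Set.mem_Ici.2 (by positivity)) (1/2) (1/2) (by norm_num) (by norm_num) (by norm_num)
      have h3 : (1/2 : ℝ) • ‖a + b‖ ^ 2 + (1/2 : ℝ) • ‖a - b‖ ^ 2 = ‖a‖ ^ 2 + ‖b‖ ^ 2 := by
        simp only [smul_eq_mul]; linarith [para a b]
      rw [h3] at h2
      simp only [smul_eq_mul] at h2
      rw [key, key, key, key]
      constructor
      · nlinarith
      · intro h; nlinarith
  · refine ⟨1, fun a b => ?_⟩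
    by_cases hab : a = 0 ∨ b = 0
    · rw [z a b hab]; simpa using hab
    · push Not at hab
      have h1 := aux_superadd (q := r / 2) (by linarith)
        (s := ‖a‖ ^ 2) (t := ‖b‖ ^ 2) (by have := norm_pos_iff.2 hab.1; positivity)
        (by have := norm_pos_iff.2 hab.2; positivity)
      have h2' := (convexOn_rpow (p := r / 2) (by linarith)).2
      have h2 := @h2' (‖a + b‖ ^ 2) (Set.mem_Ici.2 (by positivity)) (‖a - b‖ ^ 2)
        (Set.mem_Ici.2 (by positivity)) (1/2) (1/2) (by norm_num) (by norm_num) (by norm_num)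
      have h3 : (1/2 : ℝ) • ‖a + b‖ ^ 2 + (1/2 : ℝ) • ‖a - b‖ ^ 2 = ‖a‖ ^ 2 + ‖b‖ ^ 2 := by
        simp only [smul_eq_mul]; linarith [para a b]
      rw [h3] at h2
      simp only [smul_eq_mul] at h2
      rw [key, key, key, key]
      constructor
      · nlinarith
      · intro h; nlinarith

section Lp
variable {p : ℝ≥0∞} [Fact (1 ≤ p)] {Ω : Type*} [MeasurableSpace Ω] {μ : Measure Ω}

theorem aux_norm_rpow (hp_top : p ≠ ∞) (f : Lp ℂ p μ) :
    ‖f‖ ^ p.toReal = ∫ x, ‖f x‖ ^ p.toReal ∂μ := by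
  have hp0 : p ≠ 0 := (lt_of_lt_of_le one_pos Fact.out).ne'
  have hr : 0 < p.toReal := ENNReal.toReal_pos hp0 hp_top
  have h0 : 0 ≤ ∫ x, ‖f x‖ ^ p.toReal ∂μ := integral_nonneg fun x => by positivity
  rw [Lp.norm_def, (Lp.memLp f).eLpNorm_eq_integral_rpow_norm hp0 hp_top, ENNReal.toReal_ofReal
    (by positivity), ← Real.rpow_mul h0, inv_mul_cancel₀ hr.ne', Real.rpow_one]

theorem aux_int (hp_top : p ≠ ∞) (f : Lp ℂ p μ) :
    Integrable (fun x => ‖f x‖ ^ p.toReal) μ := by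
  have hp0 : p ≠ 0 := (lt_of_lt_of_le one_pos Fact.out).ne'
  exact (Lp.memLp f).integrable_norm_rpow hp0 hp_top

theorem aux_lamperti (hp_top : p ≠ ∞) (hp_two : p ≠ 2)
    (V : Lp ℂ p μ →L[ℂ] Lp ℂ p μ) (hV : ∀ f, ‖V f‖ = ‖f‖) (f g : Lp ℂ p μ)
    (hfg : ∀ᵐ x ∂μ, f x = 0 ∨ g x = 0) : ∀ᵐ x ∂μ, V f x = 0 ∨ V g x = 0 := by
  have hp0 : p ≠ 0 := (lt_of_lt_of_le one_pos Fact.out).ne'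
  have hr : 0 < p.toReal := ENNReal.toReal_pos hp0 hp_top
  have hr2 : p.toReal ≠ 2 := by
    intro h; apply hp_two
    rw [← ENNReal.ofReal_toReal hp_top, h]; simp
  set r := p.toReal with hrdef
  obtain ⟨s, hs⟩ := aux_clarkson hr hr2
  -- integral formula
  have form : ∀ f g : Lp ℂ p μ, ∫ x, s * (‖f x + g x‖ ^ r + ‖f x - g x‖ ^ r
      - 2 * ‖f x‖ ^ r - 2 * ‖g x‖ ^ r) ∂μ =
      s * (‖f + g‖ ^ r + ‖f - g‖ ^ r - 2 * ‖f‖ ^ r - 2 * ‖g‖ ^ r) ∧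
      Integrable (fun x => s * (‖f x + g x‖ ^ r + ‖f x - g x‖ ^ r
      - 2 * ‖f x‖ ^ r - 2 * ‖g x‖ ^ r)) μ := by
    intro f g
    have e1 : (fun x => ‖(f + g : Lp ℂ p μ) x‖ ^ r) =ᵐ[μ] fun x => ‖f x + g x‖ ^ r := by
      filter_upwards [Lp.coeFn_add f g] with x hx
      rw [hx]; rfl
    have e2 : (fun x => ‖(f - g : Lp ℂ p μ) x‖ ^ r) =ᵐ[μ] fun x => ‖f x - g x‖ ^ r := by
      filter_upwards [Lp.coeFn_sub f g] with x hx
      rw [hx]; rfl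
    have i1 := (aux_int hp_top (f + g)).congr e1
    have i2 := (aux_int hp_top (f - g)).congr e2
    have i3 : Integrable (fun x => 2 * ‖f x‖ ^ r) μ := (aux_int hp_top f).const_mul 2
    have i4 : Integrable (fun x => 2 * ‖g x‖ ^ r) μ := (aux_int hp_top g).const_mul 2
    have i5 : Integrable (fun x => ‖f x + g x‖ ^ r + ‖f x - g x‖ ^ r) μ := i1.add i2
    have i6 : Integrable (fun x => ‖f x + g x‖ ^ r + ‖f x - g x‖ ^ r - 2 * ‖f x‖ ^ r) μ := i5.sub i3
    refine ⟨?_, (((i1.add i2).sub i3).sub i4).const_mul s⟩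
    rw [integral_const_mul, integral_sub i6 i4, integral_sub i5 i3, integral_add i1 i2,
      integral_const_mul, integral_const_mul, hrdef, aux_norm_rpow hp_top, aux_norm_rpow hp_top,
      aux_norm_rpow hp_top, aux_norm_rpow hp_top, ← integral_congr_ae e1, ← integral_congr_ae e2]
  have z : ∫ x, s * (‖f x + g x‖ ^ r + ‖f x - g x‖ ^ r
      - 2 * ‖f x‖ ^ r - 2 * ‖g x‖ ^ r) ∂μ = 0 := by
    rw [integral_eq_zero_of_ae]
    filter_upwards [hfg] with x hx
    have : ∀ a b : ℂ, (a = 0 ∨ b = 0) →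
        s * (‖a + b‖ ^ r + ‖a - b‖ ^ r - 2 * ‖a‖ ^ r - 2 * ‖b‖ ^ r) = 0 := by
      rintro a b (rfl | rfl)
      · simp [Real.zero_rpow hr.ne']; right; ring
      · simp [Real.zero_rpow hr.ne']; right; ring
    exact this _ _ hx
  rw [(form f g).1] at z
  have z2 := (form (V f) (V g)).1
  rw [← map_add, ← map_sub, hV, hV, hV, hV, z] at z2
  have z3 := (integral_eq_zero_iff_of_nonneg (fun x => (hs _ _).1) (form (V f) (V g)).2).1 z2
  filter_upwards [z3] with x hx
  exact (hs _ _).2 hx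

/-- hermitian idempotent -/
def IsHP {B : Type*} [NormedRing B] [NormedAlgebra ℂ B] (q : B) : Prop :=
  q * q = q ∧ ∀ z : ℂ, ‖z‖ = 1 → ‖1 - q + z • q‖ ≤ 1

theorem IsHP.mulinv {B : Type*} [NormedRing B] [NormedAlgebra ℂ B] {q : B} (h : IsHP q) (z : ℂ)
    (hz : ‖z‖ = 1) : (1 - q + z⁻¹ • q) * (1 - q + z • q) = 1 := by
  have hz0 : z ≠ 0 := by rintro rfl; simp at hz
  simp only [mul_add, add_mul, mul_sub, sub_mul, mul_one, one_mul, smul_mul_assoc,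
      mul_smul_comm, h.1, smul_add, smul_sub, inv_smul_smul₀ hz0, smul_inv_smul₀ hz0]
  module

theorem aux_isom {e : Lp ℂ p μ →L[ℂ] Lp ℂ p μ} (he : IsHP e) (z : ℂ) (hz : ‖z‖ = 1)
    (f : Lp ℂ p μ) : ‖(1 - e + z • e) f‖ = ‖f‖ := by
  have a1 : ‖(1 - e + z • e) f‖ ≤ ‖f‖ := by
    simpa using ContinuousLinearMap.le_of_opNorm_le _ (he.2 z hz) f
  have a2 : ‖(1 - e + z⁻¹ • e) ((1 - e + z • e) f)‖ ≤ ‖(1 - e + z • e) f‖ := by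
    simpa using ContinuousLinearMap.le_of_opNorm_le _ (he.2 z⁻¹ (by simp [hz])) ((1 - e + z • e) f)
  have a3 : (1 - e + z⁻¹ • e) ((1 - e + z • e) f) = f := by
    rw [← mul_apply_eq_comp, he.mulinv z hz]; rfl
  rw [a3] at a2
  exact le_antisymm a1 a2

theorem aux_coe {e : Lp ℂ p μ →L[ℂ] Lp ℂ p μ} (z : ℂ) (f : Lp ℂ p μ) :
    ∀ᵐ x ∂μ, ((1 - e + z • e) f) x = f x - e f x + z * e f x := by
  have : (1 - e + z • e) f = f - e f + z • e f := by simp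
  rw [this]
  filter_upwards [Lp.coeFn_add (f - e f) (z • e f), Lp.coeFn_sub f (e f),
    Lp.coeFn_smul z (e f)] with x h1 h2 h3
  rw [h1, Pi.add_apply, h2, h3]; rfl

/-- the restriction of an `L^p` function to a measurable set -/
noncomputable def resA (A : Set Ω) (hA : MeasurableSet A) (f : Lp ℂ p μ) : Lp ℂ p μ :=
  ((Lp.memLp f).indicator hA).toLp

theorem resA_coe (A : Set Ω) (hA : MeasurableSet A) (f : Lp ℂ p μ) :
    resA A hA f =ᵐ[μ] A.indicator f := MemLp.coeFn_toLp _

theorem aux_local (hp_top : p ≠ ∞) (hp_two : p ≠ 2)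
    {e : Lp ℂ p μ →L[ℂ] Lp ℂ p μ} (he : IsHP e) (A : Set Ω) (hA : MeasurableSet A)
    (y : Lp ℂ p μ) (hy : ∀ᵐ x ∂μ, x ∈ A → y x = 0) : ∀ᵐ x ∂μ, x ∈ A → e y x = 0 := by
  set w := resA A hA (e y) with hw
  have hw' := resA_coe A hA (e y)
  have hwy : ∀ᵐ x ∂μ, w x = 0 ∨ y x = 0 := by
    filter_upwards [hy, hw'] with x h1 h2
    by_cases hx : x ∈ A
    · right; exact h1 hx
    · left; rw [hw, h2]; simp [hx]
  have L : ∀ z : ℂ, ‖z‖ = 1 → _ := fun z hz => aux_lamperti hp_top hp_two _ (aux_isom he z hz) w y hwy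
  filter_upwards [hy, hw', L (-1) (by simp), L Complex.I (by simp), aux_coe (e := e) (-1) w,
    aux_coe (e := e) (-1) y, aux_coe (e := e) Complex.I w, aux_coe (e := e) Complex.I y]
    with x h1 h2 h3 h4 h5 h6 h7 h8 hx
  have h9 : w x = e y x := by rw [hw, h2]; simp [hx]
  rw [h5, h6, h9, h1 hx] at h3
  rw [h7, h8, h9, h1 hx] at h4
  by_contra hne
  have h3' : e y x - e w x + -1 * e w x = 0 := by
    rcases h3 with h | h
    · exact h
    · exfalso; apply hne; linear_combination (-1/2) * h
  have h4' : e y x - e w x + Complex.I * e w x = 0 := by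
    rcases h4 with h | h
    · exact h
    · exfalso
      have : (Complex.I - 1) * e y x = 0 := by linear_combination h
      rcases mul_eq_zero.1 this with h | h
      · have := congrArg Complex.re h; simp at this
      · exact hne h
  have : (Complex.I + 1) * e w x = 0 := by linear_combination h4' - h3'
  rcases mul_eq_zero.1 this with h | h
  · have := congrArg Complex.re h; simp at this
  · apply hne; linear_combination h3' + 2 * h

theorem aux_res (hp_top : p ≠ ∞) (hp_two : p ≠ 2)
    {e : Lp ℂ p μ →L[ℂ] Lp ℂ p μ} (he : IsHP e) (A : Set Ω) (hA : MeasurableSet A)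
    (y : Lp ℂ p μ) : e (resA A hA y) = resA A hA (e y) := by
  have h1 := aux_local hp_top hp_two he Aᶜ hA.compl (resA A hA y) (by
    filter_upwards [resA_coe A hA y] with x hx hxA
    rw [hx]; simpa using fun h => absurd h hxA)
  have h2 := aux_local hp_top hp_two he A hA (y - resA A hA y) (by
    filter_upwards [resA_coe A hA y, Lp.coeFn_sub y (resA A hA y)] with x hx h' hxA
    rw [h', Pi.sub_apply, hx]; simp [hxA])
  rw [map_sub] at h2
  apply Lp.ext
  filter_upwards [h1, h2, resA_coe A hA (e y), Lp.coeFn_sub (e y) (e (resA A hA y))]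
    with x h1 h2 h3 h4
  rw [h3]
  by_cases hx : x ∈ A
  · have := h2 hx
    rw [h4, Pi.sub_apply, sub_eq_zero] at this
    simp [hx, this]
  · simp [hx, h1 hx]

theorem aux_ind (hp_top : p ≠ ∞) (hp_two : p ≠ 2)
    {e : Lp ℂ p μ →L[ℂ] Lp ℂ p μ} (he : IsHP e) (y : Lp ℂ p μ) :
    ∃ (A : Set Ω) (hA : MeasurableSet A), e y = resA A hA y := by
  have hp0 : p ≠ 0 := (lt_of_lt_of_le one_pos Fact.out).ne'
  have hr : 0 < p.toReal := ENNReal.toReal_pos hp0 hp_top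
  have K : ∀ z : ℂ, ‖z‖ = 1 → ∀ᵐ x ∂μ, ‖y x - e y x + z * e y x‖ = ‖y x‖ := by
    intro z hz
    have : (fun x => ‖((1 - e + z • e) y) x‖ ^ p.toReal) =ᵐ[μ] fun x => ‖y x‖ ^ p.toReal := by
      apply (aux_int hp_top _).ae_eq_of_forall_setIntegral_eq _ _ (aux_int hp_top _)
      intro A hA _
      have c : ∀ g : Lp ℂ p μ, ∫ x in A, ‖g x‖ ^ p.toReal ∂μ = ‖resA A hA g‖ ^ p.toReal := by
        intro g
        rw [aux_norm_rpow hp_top, ← integral_indicator hA]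
        apply integral_congr_ae
        filter_upwards [resA_coe A hA g] with x hx
        rw [hx]
        by_cases h : x ∈ A
        · simp [h]
        · simp [h, Real.zero_rpow hr.ne']
      rw [c, c]
      have : resA A hA ((1 - e + z • e) y) = (1 - e + z • e) (resA A hA y) := by
        apply Lp.ext
        filter_upwards [aux_coe (e := e) z y, aux_coe (e := e) z (resA A hA y),
          resA_coe A hA ((1 - e + z • e) y), resA_coe A hA y, resA_coe A hA (e y)]
          with x h1 h2 h3 h4 h5
        rw [aux_res hp_top hp_two he] at h2
        rw [h2, h3, h4, h5]
        by_cases hx : x ∈ A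
        · simp only [hx, Set.indicator_of_mem]; exact h1
        · simp [hx]
      rw [this, aux_isom he z hz]
    filter_upwards [this, aux_coe (e := e) z y] with x h1 h2
    rw [← h2]
    exact (Real.rpow_left_inj (norm_nonneg _) (norm_nonneg _) hr.ne').1 h1
  have hm : StronglyMeasurable (e y) := Lp.stronglyMeasurable _
  refine ⟨{x | e y x ≠ 0}, (measurableSet_eq_fun hm.measurable measurable_const).compl, ?_⟩
  apply Lp.ext
  filter_upwards [K (-1) (by simp), K Complex.I (by simp), K (-Complex.I) (by simp),
    resA_coe {x | e y x ≠ 0} (measurableSet_eq_fun hm.measurable measurable_const).compl y]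
    with x h1 h2 h3 h4
  rw [h4]
  by_cases hx : e y x = 0
  · simp [hx]
  · have : x ∈ {x | e y x ≠ 0} := hx
    rw [Set.indicator_of_mem this]
    set b := e y x
    obtain ⟨a, ha⟩ : ∃ a, a = y x - b := ⟨_, rfl⟩
    have hy : y x = a + b := by rw [ha]; ring
    rw [← ha, hy] at h1 h2 h3
    rw [hy]
    suffices a = 0 by rw [this, zero_add]
    have q : ∀ c d : ℂ, ‖c‖ = ‖d‖ → c.re ^ 2 + c.im ^ 2 = d.re ^ 2 + d.im ^ 2 := by
      intro c d h
      have := congrArg (fun t => t ^ 2) h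
      simp only [Complex.sq_norm, Complex.normSq_apply] at this
      linarith
    have q1 := q _ _ h1
    have q2 := q _ _ h2
    have q3 := q _ _ h3
    simp at q1 q2 q3
    have hb : 0 < b.re ^ 2 + b.im ^ 2 := by
      have := Complex.normSq_pos.2 hx
      rw [Complex.normSq_apply] at this; nlinarith
    have u1 : a.re * b.re + a.im * b.im = 0 := by linarith
    have u2 : a.im * b.re - a.re * b.im = 0 := by linarith
    have : (a.re ^ 2 + a.im ^ 2) * (b.re ^ 2 + b.im ^ 2) = 0 := by
      linear_combination (a.re * b.re + a.im * b.im) * u1 + (a.im * b.re - a.re * b.im) * u2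
    have h5 := (mul_eq_zero.1 this).resolve_right hb.ne'
    apply Complex.ext
    · simp; nlinarith [sq_nonneg a.re, sq_nonneg a.im]
    · simp; nlinarith [sq_nonneg a.re, sq_nonneg a.im]

theorem aux_comm (hp_top : p ≠ ∞) (hp_two : p ≠ 2)
    {e f : Lp ℂ p μ →L[ℂ] Lp ℂ p μ} (he : IsHP e) (hf : IsHP f) : e * f = f * e := by
  ext1 y
  obtain ⟨A, hA, h1⟩ := aux_ind hp_top hp_two he y
  obtain ⟨C, hC, h2⟩ := aux_ind hp_top hp_two hf y
  rw [mul_apply_eq_comp, mul_apply_eq_comp, h1, h2,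
    aux_res hp_top hp_two he, aux_res hp_top hp_two hf, h1, h2]
  apply Lp.ext
  filter_upwards [resA_coe C hC (resA A hA y), resA_coe A hA (resA C hC y), resA_coe C hC y,
    resA_coe A hA y] with x a1 a2 a3 a4
  rw [a1, a2]
  by_cases hx : x ∈ A <;> by_cases hx' : x ∈ C <;> simp [hx, hx', a3, a4]

end Lp
section Banach
variable {B : Type*} [NormedRing B] [NormedAlgebra ℂ B]

theorem IsHP.norm_one_le {q : B} (h : IsHP q) : ‖(1 : B)‖ ≤ 1 := by
  have := h.2 1 (by simp)
  simpa using this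

theorem IsHP.norm_le {q : B} (h : IsHP q) : ‖q‖ ≤ 1 := by
  have h1 := h.2 (-1) (by simp)
  have h2 := h.norm_one_le
  have h3 : (2 : ℂ) • q = 1 - (1 - q + (-1 : ℂ) • q) := by module
  have h4 : ‖(2 : ℂ) • q‖ ≤ 2 := by
    rw [h3]; exact (norm_sub_le _ _).trans (by linarith)
  rw [norm_smul] at h4
  simp at h4; linarith

theorem IsHP.conj {q x x' : B} (h : IsHP q) (hx : x * x' = 1) (hx' : x' * x = 1)
    (hn : ‖x‖ ≤ 1) (hn' : ‖x'‖ ≤ 1) : IsHP (x * q * x') := by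
  constructor
  · calc x * q * x' * (x * q * x') = x * q * (x' * x) * q * x' := by noncomm_ring
      _ = x * (q * q) * x' := by rw [hx']; noncomm_ring
      _ = _ := by rw [h.1]
  · intro z hz
    have : 1 - x * q * x' + z • (x * q * x') = x * (1 - q + z • q) * x' := by
      rw [mul_add, mul_sub, add_mul, sub_mul, mul_one, hx]; simp
    rw [this]
    calc _ ≤ ‖x * (1 - q + z • q)‖ * ‖x'‖ := norm_mul_le _ _
      _ ≤ ‖x‖ * ‖1 - q + z • q‖ * ‖x'‖ := by gcongr; exact norm_mul_le _ _
      _ ≤ 1 * 1 * 1 := by gcongr; exact h.2 z hz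
      _ = 1 := by norm_num

theorem idem_norm {q : B} (h : q * q = q) (h1 : ‖q‖ < 1) : q = 0 := by
  by_contra hne
  have h0 : 0 < ‖q‖ := norm_pos_iff.2 hne
  have := norm_mul_le q q
  rw [h] at this
  nlinarith

theorem idem_mul {q r : B} (hq : q * q = q) (hr : r * r = r) (h : q * r = r * q) :
    (q * r) * (q * r) = q * r := by
  calc (q * r) * (q * r) = q * (r * q) * r := by noncomm_ring
    _ = (q * q) * (r * r) := by rw [← h]; noncomm_ring
    _ = _ := by rw [hq, hr]

theorem mul_le_one3 {x y z : B} {a b c : ℝ} (hx : ‖x‖ ≤ a) (hy : ‖y‖ ≤ b) (hz : ‖z‖ ≤ c) :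
    ‖x * y * z‖ ≤ a * b * c := by
  have ha := (norm_nonneg x).trans hx
  have hb := (norm_nonneg y).trans hy
  calc _ ≤ ‖x * y‖ * ‖z‖ := norm_mul_le _ _
    _ ≤ ‖x‖ * ‖y‖ * ‖z‖ := by gcongr; exact norm_mul_le _ _
    _ ≤ a * b * c := by gcongr

/-- half of the comparison of two conjugates -/
theorem half_compare {e q u u' w w' : B} (he : e * e = e) (hq : q * q = q) (hc : q * e = e * q)
    (hw'w : w' * w = 1)
    (hu' : ‖u'‖ ≤ 1) (hqn : ‖q‖ ≤ 1) (hwn : ‖w‖ ≤ 1) (hwn' : ‖w'‖ ≤ 1) (hen : ‖e‖ ≤ 1)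
    (h1 : ‖(1 : B)‖ ≤ 1) (hd : ‖(u - w) * e‖ ≤ 2 / 5) (hu'u : u' * u = 1)
    (hcomm : (u * (q * e) * u') * (w * (q * e) * w') = (w * (q * e) * w') * (u * (q * e) * u')) :
    u * (q * e) * u' = (w * (q * e) * w') * (u * (q * e) * u') := by
  set X := u * (q * e) * u' with hX
  set Y := w * (q * e) * w' with hY
  have hqe : (q * e) * (q * e) = q * e := idem_mul hq he hc
  have hXX : X * X = X := by
    calc X * X = u * (q * e) * (u' * u) * (q * e) * u' := by rw [hX]; noncomm_ring
      _ = u * ((q * e) * (q * e)) * u' := by rw [hu'u]; noncomm_ring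
      _ = _ := by rw [hqe]
  have hYY : Y * Y = Y := by
    calc Y * Y = w * (q * e) * (w' * w) * (q * e) * w' := by rw [hY]; noncomm_ring
      _ = w * ((q * e) * (q * e)) * w' := by rw [hw'w]; noncomm_ring
      _ = _ := by rw [hqe]
  have hYn : ‖Y‖ ≤ 1 := by
    have hqen : ‖q * e‖ ≤ 1 * 1 := (norm_mul_le _ _).trans (by gcongr)
    simpa using mul_le_one3 hwn hqen hwn'
  have h1Y : ‖1 - Y‖ ≤ 2 := (norm_sub_le _ _).trans (by linarith)
  have hYw : (1 - Y) * (w * (e * q)) = 0 := by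
    have : Y * (w * (e * q)) = w * (q * e) * (w' * w) * (q * e) := by
      rw [hY, ← hc]; noncomm_ring
    rw [sub_mul, this, hw'w, mul_one, mul_assoc, hqe, ← hc]; noncomm_ring
  have hid : (1 - Y) * X = (1 - Y) * ((u - w) * e) * (q * u') := by
    have : (1 - Y) * ((u - w) * e) * (q * u') =
      (1 - Y) * (u * (e * q) * u') - (1 - Y) * (w * (e * q)) * u' := by noncomm_ring
    rw [this, hYw, ← hc]; simp [hX]
  have hsmall : ‖(1 - Y) * X‖ ≤ 2 * (2 / 5) * 1 := by
    rw [hid]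
    apply mul_le_one3 h1Y hd
    exact (norm_mul_le _ _).trans (by nlinarith [norm_nonneg q, norm_nonneg u'])
  have hzero : (1 - Y) * X = 0 := by
    apply idem_norm
    · apply idem_mul _ hXX
      · rw [sub_mul, one_mul, mul_sub, mul_one, hcomm]
      · rw [mul_sub, sub_mul, sub_mul, hYY]; simp
    · linarith
  rw [sub_mul, one_mul, sub_eq_zero] at hzero
  exact hzero

theorem compare {e q u u' w w' : B} (hK : ∀ q r : B, IsHP q → IsHP r → q * r = r * q)
    (he : IsHP e) (hq : IsHP q) (huu' : u * u' = 1) (hu'u : u' * u = 1)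
    (hww' : w * w' = 1) (hw'w : w' * w = 1)
    (hu : ‖u‖ ≤ 1) (hu' : ‖u'‖ ≤ 1) (hwn : ‖w‖ ≤ 1) (hwn' : ‖w'‖ ≤ 1)
    (hd : ‖(u - w) * e‖ ≤ 2 / 5) :
    u * (q * e) * u' = w * (q * e) * w' := by
  have hc := hK q e hq he
  have split : ∀ x x' : B, x' * x = 1 → x * (q * e) * x' = (x * q * x') * (x * e * x') := by
    intro x x' h
    calc x * (q * e) * x' = x * q * 1 * e * x' := by noncomm_ring
      _ = _ := by rw [← h]; noncomm_ring
  have hcomm : (u * (q * e) * u') * (w * (q * e) * w') =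
      (w * (q * e) * w') * (u * (q * e) * u') := by
    rw [split u u' hu'u, split w w' hw'w]
    have a1 := hq.conj huu' hu'u hu hu'
    have a2 := he.conj huu' hu'u hu hu'
    have a3 := hq.conj hww' hw'w hwn hwn'
    have a4 := he.conj hww' hw'w hwn hwn'
    have c1 : Commute (u * q * u') (w * q * w') := hK _ _ a1 a3
    have c2 : Commute (u * q * u') (w * e * w') := hK _ _ a1 a4
    have c3 : Commute (u * e * u') (w * q * w') := hK _ _ a2 a3
    have c4 : Commute (u * e * u') (w * e * w') := hK _ _ a2 a4
    exact (c1.mul_right c2).mul_left (c3.mul_right c4)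
  have e1 := half_compare he.1 hq.1 hc hw'w hu' hq.norm_le hwn hwn' he.norm_le he.norm_one_le hd
    hu'u hcomm
  have e2 := half_compare he.1 hq.1 hc hu'u hwn' hq.norm_le hu hu' he.norm_le he.norm_one_le
    (u := w) (u' := w') (w := u) (w' := u') (by rwa [← norm_neg, ← neg_mul, neg_sub])
    hw'w hcomm.symm
  rw [e1, ← hcomm]; exact e2.symm

/-- A system of spatial matrix units adapted to a subset `S` of `B`. -/
structure MU (S : Set B) (I : Type) [Fintype I] [DecidableEq I] where
  J : Type
  β : I → J
  E : I → I → B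
  ne : Nonempty I
  mul_same : ∀ k l m, β k = β l → β l = β m → E k l * E l m = E k m
  mul_ne : ∀ k l l' m, l ≠ l' → E k l * E l' m = 0
  off : ∀ k l, β k ≠ β l → E k l = 0
  sum : ∑ k, E k k = 1
  ne0 : ∀ k, E k k ≠ 0
  coef : ∀ a ∈ S, ∀ k l, ∃ α : ℂ, E k k * a * E l l = α • E k l
  perm : ∀ (σ : Equiv.Perm I) (c : I → ℂ), (∀ k, β (σ k) = β k) → (∀ k, ‖c k‖ = 1) →
    ‖∑ k, c k • E (σ k) k‖ ≤ 1

namespace MU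
variable {S : Set B} {I : Type} [Fintype I] [DecidableEq I] (m : MU S I)

theorem idem (k : I) : m.E k k * m.E k k = m.E k k := m.mul_same k k k rfl rfl

theorem sum_mul (σ : I → I) (c : I → ℂ) (l : I) :
    (∑ k, c k • m.E (σ k) k) * m.E l l = c l • (m.E (σ l) l * m.E l l) := by
  rw [Finset.sum_mul, Finset.sum_eq_single l]
  · rw [smul_mul_assoc]
  · intro k _ hk
    rw [smul_mul_assoc, m.mul_ne _ _ _ _ hk, smul_zero]
  · simp

theorem hp (k : I) : IsHP (m.E k k) := by
  refine ⟨m.idem k, fun z hz => ?_⟩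
  have := m.perm 1 (fun i => if i = k then z else 1) (by simp) (by intro i; split_ifs <;> simp [hz])
  convert this using 2
  have h2 : ∀ i, (if i = k then z else (1 : ℂ)) • m.E i i =
      m.E i i + (if i = k then (z - 1) • m.E k k else 0) := by
    intro i; split_ifs with h
    · subst h; module
    · simp
  simp only [Equiv.Perm.one_apply, h2, Finset.sum_add_distrib, m.sum]
  simp
  module

theorem norm_E_le (k l : I) : ‖m.E k l‖ ≤ 1 := by
  by_cases h : m.β k = m.β l
  · have h1 := m.perm (Equiv.swap k l) (fun _ => 1) (by
      intro i
      by_cases hk : i = k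
      · subst hk; simp [h]
      · by_cases hl : i = l
        · subst hl; simp [h]
        · rw [Equiv.swap_apply_of_ne_of_ne hk hl]) (by simp)
    have h2 := m.sum_mul (Equiv.swap k l) (fun _ => 1) l
    rw [Equiv.swap_apply_right, one_smul, m.mul_same _ _ _ h rfl] at h2
    rw [← h2]
    calc _ ≤ _ := norm_mul_le _ _
      _ ≤ 1 * 1 := mul_le_mul h1 (m.hp l).norm_le (norm_nonneg _) (by norm_num)
      _ = 1 := by norm_num
  · simp [m.off k l h]

theorem one_le_norm_diag (k : I) : 1 ≤ ‖m.E k k‖ := by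
  by_contra! h
  exact m.ne0 k (idem_norm (m.idem k) h)

theorem norm_E (k l : I) (h : m.β k = m.β l) : ‖m.E k l‖ = 1 := by
  refine le_antisymm (m.norm_E_le k l) ?_
  have h1 := m.one_le_norm_diag k
  rw [← m.mul_same k l k h h.symm] at h1
  have h2 := norm_mul_le (m.E k l) (m.E l k)
  nlinarith [m.norm_E_le l k, norm_nonneg (m.E k l)]

end MU

section main
variable {S : Set B} {I : Type} [Fintype I] [DecidableEq I] (m : MU S I)
  {u u' a : B}

theorem entry
    (hK : ∀ q r : B, IsHP q → IsHP r → q * r = r * q) (huu' : u * u' = 1)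
    (hu'u : u' * u = 1) (hu : ‖u‖ ≤ 1) (hu' : ‖u'‖ ≤ 1) (ha : a ∈ S) (hua : ‖u - a‖ ≤ 1 / 10)
    (k l : I) (hne : m.E k k * u * m.E l l ≠ 0) :
    m.β k = m.β l ∧ ∃ c : ℂ, ‖c‖ = 1 ∧ ‖m.E k k * u * m.E l l - c • m.E k l‖ ≤ 1 / 5 := by
  set t := m.E k k * u * m.E l l with ht
  have hP := m.hp k
  have hQ := (m.hp l).conj huu' hu'u hu hu'
  have hid : (m.E k k * (u * m.E l l * u')) * (m.E k k * (u * m.E l l * u')) =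
      m.E k k * (u * m.E l l * u') := idem_mul hP.1 hQ.1 (hK _ _ hP hQ)
  have htu : t * u' = m.E k k * (u * m.E l l * u') := by rw [ht]; noncomm_ring
  have hge : 1 ≤ ‖t‖ := by
    by_contra! h
    have h2 : ‖t * u'‖ < 1 := (norm_mul_le _ _).trans_lt (by nlinarith [norm_nonneg t, norm_nonneg u'])
    rw [htu] at h2
    have h3 := idem_norm hid h2
    rw [← htu] at h3
    apply hne
    calc t = t * u' * u := by rw [mul_assoc, hu'u, mul_one]
      _ = 0 := by rw [h3, zero_mul]
  have hle : ‖t‖ ≤ 1 := by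
    simpa using mul_le_one3 hP.norm_le hu (m.hp l).norm_le
  obtain ⟨α, hα⟩ := m.coef a ha k l
  have hta : ‖t - α • m.E k l‖ ≤ 1 / 10 := by
    rw [← hα, ht, ← sub_mul, ← mul_sub]
    simpa using mul_le_one3 hP.norm_le hua (m.hp l).norm_le
  have hb : m.β k = m.β l := by
    by_contra h
    rw [m.off k l h, smul_zero, sub_zero] at hta
    linarith
  refine ⟨hb, ?_⟩
  have hn := m.norm_E k l hb
  have hαn : ‖α • m.E k l‖ = ‖α‖ := by rw [norm_smul, hn, mul_one]
  have h3 : |‖t‖ - ‖α‖| ≤ 1 / 10 := by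
    rw [← hαn]; exact (abs_norm_sub_norm_le _ _).trans hta
  rw [le_antisymm hle hge] at h3
  have hα0 : 0 < ‖α‖ := by rw [abs_le] at h3; linarith
  refine ⟨α / ‖α‖, by simp [hα0.ne'], ?_⟩
  have h4 : ‖α • m.E k l - (α / ‖α‖) • m.E k l‖ ≤ 1 / 10 := by
    rw [← sub_smul, norm_smul, hn, mul_one]
    have : α - α / ‖α‖ = (α / ‖α‖) * ((‖α‖ - 1 : ℝ) : ℂ) := by
      have : (‖α‖ : ℂ) ≠ 0 := by exact_mod_cast hα0.ne'
      push_cast; field_simp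
    rw [this, norm_mul, norm_div, Complex.norm_real, Complex.norm_real, norm_norm,
      div_self hα0.ne', one_mul, Real.norm_eq_abs, abs_sub_comm]
    exact h3
  calc _ = ‖(t - α • m.E k l) + (α • m.E k l - (α / ‖α‖) • m.E k l)‖ := by congr 1; abel
    _ ≤ _ := (norm_add_le _ _).trans (by linarith)

theorem entry_flip
    (hK : ∀ q r : B, IsHP q → IsHP r → q * r = r * q) (huu' : u * u' = 1)
    (hu'u : u' * u = 1) (hu : ‖u‖ ≤ 1) (hu' : ‖u'‖ ≤ 1)
    (k l : I) (hne : m.E k k * u * m.E l l ≠ 0) :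
    m.E l l * u' * m.E k k ≠ 0 := by
  intro h
  apply hne
  have hP := m.hp k
  have hQ := (m.hp l).conj huu' hu'u hu hu'
  calc m.E k k * u * m.E l l = m.E k k * u * m.E l l * (u' * u) := by rw [hu'u, mul_one]
    _ = (m.E k k * (u * m.E l l * u')) * u := by noncomm_ring
    _ = ((u * m.E l l * u') * m.E k k) * u := by rw [hK _ _ hP hQ]
    _ = u * (m.E l l * u' * m.E k k) * u := by noncomm_ring
    _ = 0 := by rw [h]; simp

variable {a' : B}

theorem entry_uniq
    (hK : ∀ q r : B, IsHP q → IsHP r → q * r = r * q) (huu' : u * u' = 1)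
    (hu'u : u' * u = 1) (hu : ‖u‖ ≤ 1) (hu' : ‖u'‖ ≤ 1) (ha : a ∈ S) (hua : ‖u - a‖ ≤ 1 / 10)
    (ha' : a' ∈ S) (hua' : ‖u' - a'‖ ≤ 1 / 10)
    (k k' l : I) (h1 : m.E k k * u * m.E l l ≠ 0)
    (h2 : m.E k' k' * u * m.E l l ≠ 0) : k = k' := by
  by_contra hkk
  obtain ⟨b1, c1, hc1, e1⟩ := entry m hK huu' hu'u hu hu' ha hua k l h1
  have h2' := entry_flip m hK huu' hu'u hu hu' k' l h2
  obtain ⟨b2, c2, hc2, e2⟩ := entry m hK hu'u huu' hu' hu ha' hua' l k' h2'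
  have hP := m.hp k'
  have hQ := (m.hp l).conj huu' hu'u hu hu'
  set t := m.E k k * u * m.E l l with ht
  set t' := m.E l l * u' * m.E k' k' with ht'
  have hz : t * t' = 0 := by
    calc t * t' = m.E k k * u * (m.E l l * m.E l l) * u' * m.E k' k' := by
          rw [ht, ht']; noncomm_ring
      _ = m.E k k * ((u * m.E l l * u') * m.E k' k') := by rw [m.idem]; noncomm_ring
      _ = (m.E k k * m.E k' k') * (u * m.E l l * u') := by rw [← hK _ _ hP hQ]; noncomm_ring
      _ = 0 := by rw [m.mul_ne _ _ _ _ hkk, zero_mul]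
  have hp : (c1 • m.E k l) * (c2 • m.E l k') = (c1 * c2) • m.E k k' := by
    rw [smul_mul_smul_comm, m.mul_same _ _ _ b1 b2]
  have hn : ‖(c1 • m.E k l) * (c2 • m.E l k')‖ = 1 := by
    rw [hp, norm_smul, norm_mul, hc1, hc2, m.norm_E _ _ (b1.trans b2)]; norm_num
  have ht'n : ‖t'‖ ≤ 1 := by
    simpa using mul_le_one3 (m.hp l).norm_le hu' hP.norm_le
  have hEn : ‖c1 • m.E k l‖ ≤ 1 := by rw [norm_smul, hc1, one_mul]; exact m.norm_E_le _ _
  have : (c1 • m.E k l) * (c2 • m.E l k') =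
      t * t' - ((t - c1 • m.E k l) * t' + (c1 • m.E k l) * (t' - c2 • m.E l k')) := by
    noncomm_ring
  rw [this, hz, zero_sub, norm_neg] at hn
  have h3 := norm_add_le ((t - c1 • m.E k l) * t') ((c1 • m.E k l) * (t' - c2 • m.E l k'))
  have h4 := norm_mul_le (t - c1 • m.E k l) t'
  have h5 := norm_mul_le (c1 • m.E k l) (t' - c2 • m.E l k')
  nlinarith [norm_nonneg t', norm_nonneg (c1 • m.E k l), norm_nonneg (t - c1 • m.E k l),
    norm_nonneg (t' - c2 • m.E l k')]

/-- some positive power of `u` commutes with all hermitian idempotents -/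
theorem pow_commutes (m : MU S I)
    (hK : ∀ q r : B, IsHP q → IsHP r → q * r = r * q) (huu' : u * u' = 1)
    (hu'u : u' * u = 1) (hu : ‖u‖ ≤ 1) (hu' : ‖u'‖ ≤ 1) (ha : a ∈ S) (hua : ‖u - a‖ ≤ 1 / 10)
    (ha' : a' ∈ S) (hua' : ‖u' - a'‖ ≤ 1 / 10) : ∃ n : ℕ, 0 < n ∧ ∀ q : B, IsHP q → u ^ n * q = q * u ^ n := by
  have ex : ∀ l, ∃ k, m.E k k * u * m.E l l ≠ 0 := by
    intro l
    by_contra! h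
    have h1 : u * m.E l l = 0 := by
      calc u * m.E l l = (∑ k, m.E k k) * (u * m.E l l) := by rw [m.sum, one_mul]
        _ = ∑ k, m.E k k * u * m.E l l := by
          rw [Finset.sum_mul]; exact Finset.sum_congr rfl fun k _ => by rw [mul_assoc]
        _ = 0 := Finset.sum_eq_zero fun k _ => h k
    apply m.ne0 l
    calc m.E l l = u' * (u * m.E l l) := by rw [← mul_assoc, hu'u, one_mul]
      _ = 0 := by rw [h1, mul_zero]
  choose s hs using ex
  have sinj : Function.Injective s := by
    intro l l' h
    have f1 := entry_flip m hK huu' hu'u hu hu' _ _ (hs l)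
    have f2 := entry_flip m hK huu' hu'u hu hu' _ _ (hs l')
    rw [← h] at f2
    exact entry_uniq m hK hu'u huu' hu' hu ha' hua' ha hua _ _ _ f1 f2
  have huE : ∀ l, u * m.E l l = m.E (s l) (s l) * u * m.E l l := by
    intro l
    calc u * m.E l l = (∑ k, m.E k k) * (u * m.E l l) := by rw [m.sum, one_mul]
      _ = ∑ k, m.E k k * u * m.E l l := by
        rw [Finset.sum_mul]; exact Finset.sum_congr rfl fun k _ => by rw [mul_assoc]
      _ = _ := by
        rw [Finset.sum_eq_single (s l)]
        · intro k _ hk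
          by_contra h
          exact hk (entry_uniq m hK huu' hu'u hu hu' ha hua ha' hua' _ _ _ h (hs l))
        · simp
  set σ : Equiv.Perm I := Equiv.ofBijective s (Finite.injective_iff_bijective.1 sinj) with hσ
  have hσs : ∀ l, σ l = s l := fun l => rfl
  have hen := fun l => entry m hK huu' hu'u hu hu' ha hua _ _ (hs l)
  have hβ : ∀ l, m.β (σ l) = m.β l := fun l => (hen l).1
  choose c hc1 hc2 using fun l => (hen l).2
  set w : B := ∑ l, c l • m.E (σ l) l with hw
  set w' : B := ∑ k, (c (σ.symm k))⁻¹ • m.E (σ.symm k) k with hw'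
  have hw'2 : w' = ∑ l, (c l)⁻¹ • m.E l (σ l) := by
    rw [hw', ← Equiv.sum_comp σ]; simp
  have hc0 : ∀ l, c l ≠ 0 := fun l h => by have := hc1 l; rw [h] at this; simp at this
  have hwn : ‖w‖ ≤ 1 := m.perm σ c hβ hc1
  have hwn' : ‖w'‖ ≤ 1 := m.perm σ.symm (fun k => (c (σ.symm k))⁻¹)
    (fun k => by rw [← hβ (σ.symm k)]; simp) (fun k => by simp [hc1])
  have hww' : w * w' = 1 := by
    rw [hw'2, Finset.mul_sum]
    have : ∀ l, w * ((c l)⁻¹ • m.E l (σ l)) = m.E (σ l) (σ l) := by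
      intro l
      rw [mul_smul_comm, ← m.mul_same l l (σ l) rfl (hβ l).symm, ← mul_assoc, hw, m.sum_mul,
        smul_mul_assoc, smul_smul, inv_mul_cancel₀ (hc0 l), one_smul, m.mul_same _ _ _ (hβ l) rfl,
        m.mul_same _ _ _ (hβ l) (hβ l).symm]
    rw [Finset.sum_congr rfl fun l _ => this l, Equiv.sum_comp σ (fun k => m.E k k), m.sum]
  have hw'w : w' * w = 1 := by
    rw [hw, Finset.mul_sum]
    have : ∀ l, w' * (c l • m.E (σ l) l) = m.E l l := by
      intro l
      rw [mul_smul_comm, ← m.mul_same (σ l) (σ l) l rfl (hβ l), ← mul_assoc, hw', m.sum_mul,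
        smul_mul_assoc, smul_smul, Equiv.symm_apply_apply, mul_inv_cancel₀ (hc0 l), one_smul,
        m.mul_same _ _ _ (hβ l).symm rfl, m.mul_same _ _ _ (hβ l).symm (hβ l)]
    rw [Finset.sum_congr rfl fun l _ => this l, m.sum]
  have hwE : ∀ l, w * m.E l l = c l • m.E (σ l) l := by
    intro l; rw [hw, m.sum_mul, m.mul_same _ _ _ (hβ l) rfl]
  have hd : ∀ l, ‖(u - w) * m.E l l‖ ≤ 2 / 5 := by
    intro l
    rw [sub_mul, hwE, huE]
    exact (hc2 l).trans (by norm_num)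
  have hconj : ∀ q, IsHP q → u * q * u' = w * q * w' := by
    intro q hq
    have hsum : q = ∑ l, q * m.E l l := by rw [← Finset.mul_sum, m.sum, mul_one]
    rw [hsum]
    simp only [Finset.mul_sum, Finset.sum_mul]
    exact Finset.sum_congr rfl fun l _ =>
      compare hK (m.hp l) hq huu' hu'u hww' hw'w hu hu' hwn hwn' (hd l)
  have hpow : ∀ n : ℕ, ∀ q, IsHP q → u ^ n * q * u' ^ n = w ^ n * q * w' ^ n := by
    intro n
    induction n with
    | zero => intro q _; simp
    | succ n ih =>
      intro q hq
      calc u ^ (n + 1) * q * u' ^ (n + 1) = u ^ n * (u * q * u') * u' ^ n := by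
            rw [pow_succ u, pow_succ' u']; noncomm_ring
        _ = w ^ n * (u * q * u') * w' ^ n := ih _ (hq.conj huu' hu'u hu hu')
        _ = _ := by rw [hconj q hq, pow_succ w, pow_succ' w']; noncomm_ring
  have hβn : ∀ (n : ℕ) l, m.β ((σ ^ n) l) = m.β l := by
    intro n
    induction n with
    | zero => intro l; simp
    | succ n ih => intro l; rw [pow_succ', Equiv.Perm.mul_apply, hβ, ih]
  have hwpow : ∀ n : ℕ, ∃ d : I → ℂ, w ^ n = ∑ l, d l • m.E ((σ ^ n) l) l := by
    intro n
    induction n with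
    | zero => exact ⟨fun _ => 1, by simp [m.sum]⟩
    | succ n ih =>
      obtain ⟨d, hd⟩ := ih
      refine ⟨fun l => d l * c ((σ ^ n) l), ?_⟩
      rw [pow_succ', hd, Finset.mul_sum]
      refine Finset.sum_congr rfl fun l _ => ?_
      rw [mul_smul_comm, ← m.mul_same ((σ ^ n) l) ((σ ^ n) l) l rfl (hβn n l), ← mul_assoc, hwE,
        smul_mul_assoc, m.mul_same _ _ _ (hβ _) (hβn n l), smul_smul, pow_succ',
        Equiv.Perm.mul_apply]
  refine ⟨orderOf σ, orderOf_pos σ, fun q hq => ?_⟩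
  set n := orderOf σ with hn
  obtain ⟨d, hd'⟩ := hwpow n
  have hwq : w ^ n * q = q * w ^ n := by
    rw [hd', hn, pow_orderOf_eq_one, Finset.sum_mul, Finset.mul_sum]
    refine Finset.sum_congr rfl fun l _ => ?_
    rw [Equiv.Perm.one_apply, smul_mul_assoc, mul_smul_comm, hK _ _ (m.hp l) hq]
  have hinv : ∀ (x x' : B), x * x' = 1 → x ^ n * x' ^ n = 1 := by
    intro x x' h
    generalize n = n
    induction n with
    | zero => simp
    | succ n ih => rw [pow_succ, pow_succ', mul_assoc, ← mul_assoc x, h, one_mul, ih]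
  have h1 := hpow n q hq
  rw [hwq, mul_assoc q, hinv _ _ hww', mul_one] at h1
  calc u ^ n * q = u ^ n * q * (u' ^ n * u ^ n) := by rw [hinv _ _ hu'u, mul_one]
    _ = (u ^ n * q * u' ^ n) * u ^ n := by noncomm_ring
    _ = _ := by rw [h1]

end main

theorem abstract_main (hK : ∀ q r : B, IsHP q → IsHP r → q * r = r * q)
    (Bs : ℕ → Set B) (hmono : Monotone Bs) (hd : Dense (⋃ j, Bs j))
    (hMU : ∀ j, ∃ (I : Type) (_ : Fintype I) (_ : DecidableEq I), Nonempty (MU (Bs j) I))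
    {u u' v v' : B} (huu' : u * u' = 1) (hu'u : u' * u = 1) (hu : ‖u‖ ≤ 1) (hu' : ‖u'‖ ≤ 1)
    (hv'v : v' * v = 1) (hv' : ‖v'‖ ≤ 1)
    (hvc : ∀ q, IsHP q → v * q = q * v)
    (z : ℂ) (hz : ∀ n : ℕ, 0 < n → z ^ n ≠ 1) (huv : u * v = z • (v * u)) : False := by
  have approx : ∀ x : B, ∀ ε > 0, ∃ j, ∃ a ∈ Bs j, ‖x - a‖ ≤ ε := by
    intro x ε hε
    obtain ⟨y, hy, hxy⟩ := Metric.dense_iff.1 hd x ε hε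
    obtain ⟨j, hj⟩ := Set.mem_iUnion.1 hxy
    exact ⟨j, y, hj, by rw [← dist_eq_norm, dist_comm]; exact (Metric.mem_ball.1 hy).le⟩
  obtain ⟨j1, a, ha, hua⟩ := approx u (1 / 10) (by norm_num)
  obtain ⟨j2, a', ha', hua'⟩ := approx u' (1 / 10) (by norm_num)
  obtain ⟨I, _, _, ⟨m⟩⟩ := hMU (max j1 j2)
  obtain ⟨n, hn, hcomm⟩ := pow_commutes m hK huu' hu'u hu hu' (hmono (le_max_left _ _) ha) hua
    (hmono (le_max_right _ _) ha') hua'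
  have hzn := sub_ne_zero.2 (hz n hn)
  have hzpos : 0 < ‖z ^ n - 1‖ := norm_pos_iff.2 hzn
  obtain ⟨j3, b, hb, hvb⟩ := approx v (‖z ^ n - 1‖ / 4) (by positivity)
  obtain ⟨I', _, _, ⟨m'⟩⟩ := hMU j3
  obtain ⟨l⟩ := m'.ne
  set e := m'.E l l with he
  have hP : IsHP e := m'.hp l
  obtain ⟨α, hα⟩ := m'.coef b hb l l
  rw [← he] at hα
  have hve : v * e = e * v * e := by rw [← hvc e hP, mul_assoc, hP.1]
  have h1 : ‖v * e - α • e‖ ≤ ‖z ^ n - 1‖ / 4 := by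
    rw [hve, ← hα, ← sub_mul, ← mul_sub]
    simpa using mul_le_one3 hP.norm_le hvb hP.norm_le
  have hpown : ∀ k : ℕ, u ^ k * v = z ^ k • (v * u ^ k) := by
    intro k
    induction k with
    | zero => simp
    | succ k ih =>
      rw [pow_succ', mul_assoc, ih, mul_smul_comm, ← mul_assoc, huv, smul_mul_assoc, smul_smul,
        mul_assoc, ← pow_succ]
  have hinv : u ^ n * u' ^ n = 1 := by
    generalize n = n
    induction n with
    | zero => simp
    | succ n ih => rw [pow_succ, pow_succ', mul_assoc, ← mul_assoc u, huu', one_mul, ih]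
  have hnpow : ∀ (x : B), ‖x‖ ≤ 1 → ∀ k : ℕ, ‖x ^ k‖ ≤ 1 := by
    intro x hx k
    induction k with
    | zero => simpa using hP.norm_one_le
    | succ k ih =>
      rw [pow_succ]
      exact (norm_mul_le _ _).trans (by nlinarith [norm_nonneg x, norm_nonneg (x ^ k)])
  have h2 : u ^ n * (v * e - α • e) * u' ^ n = z ^ n • (v * e) - α • e := by
    rw [mul_sub, sub_mul, ← mul_assoc, hpown, mul_smul_comm, hcomm e hP]
    simp only [smul_mul_assoc]
    rw [mul_assoc v, hcomm e hP, ← mul_assoc, mul_assoc (v * e), hinv, mul_one, mul_assoc e, hinv,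
      mul_one]
  have h3 : ‖z ^ n • (v * e) - α • e‖ ≤ ‖z ^ n - 1‖ / 4 := by
    rw [← h2]
    simpa using mul_le_one3 (hnpow u hu n) h1 (hnpow u' hu' n)
  have h4 : (z ^ n - 1) • (v * e) = (z ^ n • (v * e) - α • e) - (v * e - α • e) := by module
  have h5 : ‖z ^ n - 1‖ * ‖v * e‖ ≤ ‖z ^ n - 1‖ / 2 := by
    rw [← norm_smul, h4]
    exact (norm_sub_le _ _).trans (by linarith)
  have h6 : 1 ≤ ‖v * e‖ := by
    have h7 := m'.one_le_norm_diag l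
    rw [← he] at h7
    have h8 : e = v' * (v * e) := by rw [← mul_assoc, hv'v, one_mul]
    have h9 := norm_mul_le v' (v * e)
    rw [← h8] at h9
    nlinarith [norm_nonneg (v * e), norm_nonneg v']
  nlinarith

end Banach


theorem lp_opnorm_le {α : Type*} {p : ℝ≥0∞} [Fact (1 ≤ p)] (hp : p ≠ ∞)
    (T : lp (fun _ : α => ℂ) p →L[ℂ] lp (fun _ : α => ℂ) p) (τ : α → α)
    (hτ : Function.Injective τ) (C : ℝ) (hC : 0 ≤ C)
    (h : ∀ ξ a, ‖T ξ a‖ ≤ C * ‖ξ (τ a)‖) : ‖T‖ ≤ C := by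
  have hp0 : 0 < p.toReal :=
    ENNReal.toReal_pos (zero_lt_one.trans_le (Fact.out : 1 ≤ p)).ne' hp
  refine T.opNorm_le_bound hC fun ξ => ?_
  have hs : Summable fun a => ‖ξ a‖ ^ p.toReal := (lp.memℓp ξ).summable hp0
  have hs2 : Summable fun a => ‖ξ (τ a)‖ ^ p.toReal := hs.comp_injective hτ
  refine lp.norm_le_of_tsum_le hp0 (by positivity) ?_
  rw [Real.mul_rpow hC (norm_nonneg _), lp.norm_rpow_eq_tsum hp0]
  calc ∑' i, ‖T ξ i‖ ^ p.toReal ≤ ∑' i, C ^ p.toReal * ‖ξ (τ i)‖ ^ p.toReal := by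
        refine Summable.tsum_le_tsum (fun i => ?_) ((lp.memℓp (T ξ)).summable hp0)
          (hs2.mul_left _)
        rw [← Real.mul_rpow hC (norm_nonneg _)]
        exact Real.rpow_le_rpow (norm_nonneg _) (h ξ i) hp0.le
    _ = C ^ p.toReal * ∑' i, ‖ξ (τ i)‖ ^ p.toReal := tsum_mul_left
    _ ≤ _ := by
        refine mul_le_mul_of_nonneg_left ?_ (by positivity)
        exact tsum_comp_le_tsum_of_inj hs (fun _ => by positivity) hτ

def lpFinEquiv (n : ℕ) (p : ℝ≥0∞) : (Fin n → ℂ) ≃ₗ[ℂ] lp (fun _ : Fin n => ℂ) p where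
  toFun f := ⟨f, Memℓp.all f⟩
  invFun ξ := fun i => ξ i
  left_inv f := rfl
  right_inv ξ := rfl
  map_add' f g := rfl
  map_smul' c f := rfl

instance lpFinFD (n : ℕ) (p : ℝ≥0∞) : FiniteDimensional ℂ (lp (fun _ : Fin n => ℂ) p) :=
  LinearEquiv.finiteDimensional (lpFinEquiv n p)

noncomputable def matOp (n : ℕ) (p : ℝ≥0∞) [Fact (1 ≤ p)] : Matrix (Fin n) (Fin n) ℂ ≃ₐ[ℂ]
    (lp (fun _ : Fin n => ℂ) p →L[ℂ] lp (fun _ : Fin n => ℂ) p) :=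
  ((Matrix.toLinAlgEquiv').trans ((lpFinEquiv n p).conjAlgEquiv ℂ)).trans
    (Module.End.toContinuousLinearMap (lp (fun _ : Fin n => ℂ) p))

theorem matOp_apply (n : ℕ) (p : ℝ≥0∞) [Fact (1 ≤ p)] (A : Matrix (Fin n) (Fin n) ℂ)
    (ξ : lp (fun _ : Fin n => ℂ) p) (t : Fin n) : matOp n p A ξ t = ∑ s, A t s * ξ s := by
  rfl

section MUc
variable {m : ℕ} {N : Fin m → ℕ}

def EDm (k l : Σ i, Fin (N i)) : ∀ i, Matrix (Fin (N i)) (Fin (N i)) ℂ :=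
  Matrix.blockDiag' (Matrix.single k l 1)

theorem bd_EDm (k l : Σ i, Fin (N i)) (h : k.1 = l.1) :
    Matrix.blockDiagonal' (EDm k l) = Matrix.single k l (1 : ℂ) := by
  ext ⟨i, t⟩ ⟨i', s⟩
  rw [Matrix.blockDiagonal'_apply]
  split_ifs with hi
  · obtain rfl : i = i' := hi
    rfl
  · symm
    apply Matrix.single_apply_of_ne
    rintro ⟨rfl, rfl⟩
    exact hi h

theorem EDm_ne (k l : Σ i, Fin (N i)) (h : k.1 ≠ l.1) : EDm k l = 0 := by
  ext i t s
  apply Matrix.single_apply_of_ne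
  rintro ⟨rfl, rfl⟩
  exact h rfl

theorem EDm_mul (k l l' n : Σ i, Fin (N i)) (h : k.1 = l.1) (h' : l'.1 = n.1) :
    Matrix.blockDiagonal' (EDm k l * EDm l' n) =
      Matrix.single k l (1 : ℂ) * Matrix.single l' n 1 := by
  rw [← bd_EDm _ _ h, ← bd_EDm _ _ h', ← Matrix.blockDiagonal'_mul]; rfl

theorem mkMU {B : Type*} [NormedRing B] [NormedAlgebra ℂ B] (S : Subalgebra ℂ B)
    (hm : 0 < m) (hN : ∀ i, 0 < N i)
    (Φ : (∀ i, Matrix (Fin (N i)) (Fin (N i)) ℂ) ≃ₐ[ℂ] S)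
    (hΦ : ∀ D, (∀ i, ∃ τ : Fin (N i) → Fin (N i), Function.Injective τ ∧
      ∀ t, ∃ c : ℂ, ‖c‖ = 1 ∧ D i t = Pi.single (τ t) c) → ‖(Φ D : B)‖ ≤ 1) :
    Nonempty (MU (S : Set B) (Σ i, Fin (N i))) := by
  have inj := Matrix.blockDiagonal'_injective (o := Fin m) (m' := fun i => Fin (N i)) (n' := fun i => Fin (N i)) (α := ℂ)
  have hdiag : ∀ (k l : Σ i, Fin (N i)) (x : ∀ i, Matrix (Fin (N i)) (Fin (N i)) ℂ),
      ∃ α : ℂ, EDm (N := N) k k * x * EDm (N := N) l l = α • EDm (N := N) k l := by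
    intro k l x
    refine ⟨Matrix.blockDiagonal' x k l, ?_⟩
    by_cases h : k.1 = l.1
    · apply inj
      have : Matrix.blockDiagonal' (EDm k k * x * EDm l l) = Matrix.blockDiagonal' (EDm k k) *
        Matrix.blockDiagonal' x * Matrix.blockDiagonal' (EDm l l) := by
        rw [← Matrix.blockDiagonal'_mul, ← Matrix.blockDiagonal'_mul]; rfl
      rw [this, bd_EDm _ _ rfl, bd_EDm _ _ rfl, Matrix.blockDiagonal'_smul, bd_EDm _ _ h]
      simp
    · rw [EDm_ne k l h, smul_zero]
      apply inj
      have : Matrix.blockDiagonal' (EDm k k * x * EDm l l) = Matrix.blockDiagonal' (EDm k k) *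
        Matrix.blockDiagonal' x * Matrix.blockDiagonal' (EDm l l) := by
        rw [← Matrix.blockDiagonal'_mul, ← Matrix.blockDiagonal'_mul]; rfl
      rw [this, bd_EDm _ _ rfl, bd_EDm _ _ rfl, Matrix.blockDiagonal'_zero]
      have : Matrix.blockDiagonal' x k l = 0 := by
        rw [Matrix.blockDiagonal'_apply, dif_neg h]
      simp [this]
  refine ⟨{ J := Fin m, β := Sigma.fst, E := fun k l => (Φ (EDm k l) : B), ne := ⟨⟨⟨0, hm⟩, ⟨0, hN _⟩⟩⟩, mul_same := ?_, mul_ne := ?_, off := ?_, sum := ?_, ne0 := ?_, coef := ?_, perm := ?_ }⟩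
  · intro k l n h h'
    rw [← S.coe_mul, ← map_mul]
    congr 2
    apply inj
    rw [EDm_mul _ _ _ _ h h', bd_EDm _ _ (h.trans h')]
    simp
  · intro k l l' n h
    rw [← S.coe_mul, ← map_mul, ← S.coe_zero, ← map_zero Φ]
    congr 2
    by_cases h1 : k.1 = l.1
    · by_cases h2 : l'.1 = n.1
      · apply inj
        rw [EDm_mul _ _ _ _ h1 h2, Matrix.single_mul_single_of_ne _ _ _ _ h,
          Matrix.blockDiagonal'_zero]
      · rw [EDm_ne _ _ h2, mul_zero]
    · rw [EDm_ne _ _ h1, zero_mul]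
  · intro k l h
    rw [EDm_ne _ _ h, map_zero, S.coe_zero]
  · rw [← AddSubmonoidClass.coe_finsetSum, ← map_sum, ← S.coe_one, ← map_one Φ]
    congr 2
    ext i t s
    rw [Finset.sum_apply, Matrix.sum_apply]
    simp only [EDm, Matrix.blockDiag'_apply, Matrix.single_apply, Pi.one_apply, Matrix.one_apply]
    by_cases hts : t = s
    · subst hts; simp
    · rw [if_neg hts]
      apply Finset.sum_eq_zero
      rintro k -
      rw [if_neg]
      rintro ⟨rfl, h⟩
      exact hts (by simpa using h)
  · intro k h
    have h2 : Φ (EDm k k) = 0 := by ext; exact h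
    rw [map_eq_zero_iff Φ Φ.injective] at h2
    have := congrFun (congrFun (congrFun h2 k.1) k.2) k.2
    simp [EDm, Matrix.blockDiag'_apply] at this
  · intro a ha k l
    obtain ⟨α, hα⟩ := hdiag k l (Φ.symm ⟨a, ha⟩)
    refine ⟨α, ?_⟩
    have := congrArg (fun x => (Φ x : B)) hα
    simpa using this
  · intro σ c hσ hc
    have : ∑ k, c k • (Φ (EDm (σ k) k) : B) = (Φ (∑ k, c k • EDm (σ k) k) : B) := by
      rw [map_sum, AddSubmonoidClass.coe_finsetSum]
      simp
    rw [this]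
    apply hΦ
    intro i
    have hσ' : ∀ k, (σ.symm k).1 = k.1 := fun k => by
      have := hσ (σ.symm k); simpa using this.symm
    have : ∀ t, ∃ s, σ.symm ⟨i, t⟩ = ⟨i, s⟩ := by
      intro t
      have := hσ' ⟨i, t⟩
      rcases h : σ.symm ⟨i, t⟩ with ⟨i', s⟩
      rw [h] at this
      dsimp at this
      subst this
      exact ⟨s, rfl⟩
    choose τ hτ using this
    refine ⟨τ, ?_, ?_⟩
    · intro t t' h
      have : σ.symm ⟨i, t⟩ = σ.symm ⟨i, t'⟩ := by rw [hτ, hτ, h]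
      simpa using this
    · intro t
      refine ⟨c ⟨i, τ t⟩, hc _, ?_⟩
      ext s
      rw [Finset.sum_apply, Matrix.sum_apply, Finset.sum_eq_single ⟨i, τ t⟩]
      · rw [← hτ]
        simp only [EDm, Pi.smul_apply, Matrix.smul_apply, Matrix.blockDiag'_apply, Matrix.single_apply, Equiv.apply_symm_apply, Pi.single_apply]
        rw [hτ]
        by_cases h : s = τ t
        · simp [h]
        · have : ¬ τ t = s := fun h' => h h'.symm
          simp [h, this]
      · intro k _ hk
        have : σ k ≠ ⟨i, t⟩ := by
          intro h; apply hk; rw [← hτ, ← h]; simp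
        simp [EDm, Matrix.blockDiag'_apply, Matrix.single_apply, this]
      · simp

theorem mkMU' {B : Type*} [NormedRing B] [NormedAlgebra ℂ B] (S : Subalgebra ℂ B)
    {p : ℝ≥0∞} [Fact (1 ≤ p)] (hp : p ≠ ∞)
    (hm : 0 < m) (hN : ∀ i, 0 < N i)
    (e : S ≃ₐ[ℂ] (∀ i : Fin m,
          (lp (fun _ : Fin (N i) => ℂ) p →L[ℂ] lp (fun _ : Fin (N i) => ℂ) p)))
    (he : ∀ b : S, ‖e b‖ = ‖b‖) :
    Nonempty (MU (S : Set B) (Σ i, Fin (N i))) := by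
  refine mkMU S hm hN ((AlgEquiv.piCongrRight fun i => matOp (N i) p).trans e.symm) ?_
  intro D hD
  have : ∀ x : S, ‖(x : B)‖ = ‖e x‖ := fun x => (he x).symm
  rw [this]
  simp only [AlgEquiv.trans_apply, AlgEquiv.apply_symm_apply]
  rw [pi_norm_le_iff_of_nonneg zero_le_one]
  intro i
  obtain ⟨τ, hτ, h⟩ := hD i
  refine lp_opnorm_le hp _ τ hτ 1 zero_le_one fun ξ t => ?_
  obtain ⟨c, hc, hct⟩ := h t
  rw [AlgEquiv.piCongrRight_apply, matOp_apply, hct]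
  simp [Pi.single_apply, hc]
end MUc


theorem idem_eq_of_close {B : Type*} [NormedRing B] [NormedAlgebra ℂ B] {q r : B}
    (hq : q * q = q) (hr : r * r = r) (h : q * r = r * q) (hd : ‖q - r‖ < 1) : q = r := by
  have h1 : (q - r) * (q - r) * (q - r) = q - r := by
    have a1 : q * r * q = q * r := by rw [h, mul_assoc, hq]
    have a2 : (q - r) * (q - r) = q + r - q * r - q * r := by
      rw [sub_mul, mul_sub, mul_sub, hq, hr, ← h]; abel
    have a3 : r * q * r = q * r := by rw [← h, mul_assoc, hr]
    have a4 : q * r * r = q * r := by rw [mul_assoc, hr]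
    rw [a2]
    simp only [sub_mul, mul_sub, add_mul, hq, hr, a1, a4, ← h]
    abel
  have h2 : (q - r) * (q - r) = 0 := by
    apply idem_norm
    · rw [← mul_assoc, h1]
    · calc _ ≤ ‖q - r‖ * ‖q - r‖ := norm_mul_le _ _
        _ < 1 := by nlinarith [norm_nonneg (q - r)]
  rw [h2, zero_mul] at h1
  exact sub_eq_zero.1 h1.symm

section comm
variable {B : Type*} [NormedRing B] [NormedAlgebra ℂ B]
variable {X : Type*} [TopologicalSpace X] [CompactSpace X]

noncomputable def expC (F : C(X, ℝ)) (t : ℝ) : C(X, ℂ) where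
  toFun x := Complex.exp (Complex.I * ((t * F x : ℝ) : ℂ))
  continuous_toFun := by fun_prop

theorem expC_add (F : C(X, ℝ)) (s t : ℝ) : expC F (s + t) = expC F s * expC F t := by
  ext x
  simp only [expC, ContinuousMap.coe_mk, ContinuousMap.mul_apply, ← Complex.exp_add]
  congr 1
  push_cast; ring

theorem expC_zero (F : C(X, ℝ)) : expC F 0 = 1 := by
  ext x
  simp [expC]

theorem expC_nat (F : C(X, ℝ)) (t : ℝ) (n : ℕ) : expC F (n * t) = expC F t ^ n := by
  induction n with
  | zero => simp [expC_zero]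
  | succ n ih => rw [pow_succ, ← ih, ← expC_add]; congr 1; push_cast; ring

theorem expC_norm (F : C(X, ℝ)) (t : ℝ) : ‖expC F t‖ ≤ 1 := by
  rw [ContinuousMap.norm_le _ zero_le_one]
  intro x
  simp only [expC, ContinuousMap.coe_mk, mul_comm Complex.I, Complex.norm_exp_ofReal_mul_I]
  exact le_rfl

theorem expC_sub_norm (F : C(X, ℝ)) (t : ℝ) : ‖expC F t - 1‖ ≤ |t| * ‖F‖ := by
  rw [ContinuousMap.norm_le _ (by positivity)]
  intro x
  refine (Real.norm_exp_I_mul_ofReal_sub_one_le (x := t * F x)).trans ?_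
  rw [norm_mul, Real.norm_eq_abs]
  gcongr
  exact F.norm_coe_le_norm x

theorem expC_comm (hK : ∀ q r : B, IsHP q → IsHP r → q * r = r * q)
    (ρ : C(X, ℂ) →ₐ[ℂ] B) (hρ : ∀ f, ‖ρ f‖ ≤ ‖f‖) (F : C(X, ℝ)) (q : B) (hq : IsHP q) :
    Commute (ρ (expC F 1)) q := by
  obtain ⟨n, hn⟩ := exists_nat_gt (2 * ‖F‖)
  have hn0 : (0 : ℝ) < n := lt_of_le_of_lt (by positivity) hn
  set x := ρ (expC F (1 / n)) with hx
  set x' := ρ (expC F (-(1 / n))) with hx'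
  have h1 : x * x' = 1 := by rw [hx, hx', ← map_mul, ← expC_add, add_neg_cancel, expC_zero, map_one]
  have h2 : x' * x = 1 := by rw [hx, hx', ← map_mul, ← expC_add, neg_add_cancel, expC_zero, map_one]
  have n1 : ‖x‖ ≤ 1 := (hρ _).trans (expC_norm _ _)
  have n2 : ‖x'‖ ≤ 1 := (hρ _).trans (expC_norm _ _)
  have n3 : ‖x - 1‖ ≤ 1 / n * ‖F‖ := by
    rw [hx, ← map_one ρ, ← map_sub]
    refine (hρ _).trans ((expC_sub_norm _ _).trans ?_)
    rw [abs_of_pos (by positivity)]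
  have hc := hq.conj h1 h2 n1 n2
  have hqn := hq.norm_le
  have heq : x * q * x' = q := by
    refine idem_eq_of_close hc.1 hq.1 (hK _ _ hc hq) ?_
    have e1 : x * q * x' - q = ((x - 1) * q - q * (x - 1)) * x' := by
      have : q = q * (x * x') := by rw [h1, mul_one]
      nth_rw 2 [this]
      noncomm_ring
    rw [e1]
    calc _ ≤ ‖(x - 1) * q - q * (x - 1)‖ * ‖x'‖ := norm_mul_le _ _
      _ ≤ (‖x - 1‖ * ‖q‖ + ‖q‖ * ‖x - 1‖) * ‖x'‖ := by
        gcongr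
        exact (norm_sub_le _ _).trans (add_le_add (norm_mul_le _ _) (norm_mul_le _ _))
      _ ≤ (1 / n * ‖F‖ * 1 + 1 * (1 / n * ‖F‖)) * 1 := by gcongr
      _ = 2 * ‖F‖ / n := by ring
      _ < 1 := by rw [div_lt_one hn0]; exact hn
  have hcx : Commute x q := by
    show x * q = q * x
    calc x * q = x * q * (x' * x) := by rw [h2, mul_one]
      _ = x * q * x' * x := by noncomm_ring
      _ = q * x := by rw [heq]
  have : ρ (expC F 1) = x ^ n := by
    rw [hx, ← map_pow, ← expC_nat]
    congr 2
    field_simp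
  rw [this]
  exact hcx.pow_left n

theorem real_comm (hK : ∀ q r : B, IsHP q → IsHP r → q * r = r * q)
    (ρ : C(X, ℂ) →ₐ[ℂ] B) (hρ : ∀ f, ‖ρ f‖ ≤ ‖f‖) (G : C(X, ℝ)) (hG : ∀ x, |G x| ≤ 1)
    (f : C(X, ℂ)) (hf : ∀ x, f x = (G x : ℂ)) (q : B) (hq : IsHP q) :
    Commute (ρ f) q := by
  let F : C(X, ℝ) := ⟨fun x => Real.arccos (G x), Real.continuous_arccos.comp G.continuous⟩
  have : f = (1 / 2 : ℂ) • (expC F 1 + expC (-F) 1) := by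
    ext x
    have h1 := abs_le.1 (hG x)
    have h2 : (G x : ℂ) = Complex.cos (F x) := by
      rw [← Complex.ofReal_cos]
      congr 1
      exact (Real.cos_arccos h1.1 h1.2).symm
    rw [hf, h2, Complex.cos]
    simp only [expC, ContinuousMap.smul_apply, ContinuousMap.add_apply, ContinuousMap.coe_mk,
      ContinuousMap.neg_apply, smul_eq_mul]
    push_cast
    simp only [one_mul, mul_neg, neg_mul, mul_comm Complex.I]
    ring
  rw [this, map_smul, map_add]
  exact ((expC_comm hK ρ hρ F q hq).add_left (expC_comm hK ρ hρ _ q hq)).smul_left _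

theorem unit_comm (hK : ∀ q r : B, IsHP q → IsHP r → q * r = r * q)
    (ρ : C(X, ℂ) →ₐ[ℂ] B) (hρ : ∀ f, ‖ρ f‖ ≤ ‖f‖) (f : C(X, ℂ)) (hf : ∀ x, ‖f x‖ ≤ 1)
    (q : B) (hq : IsHP q) : Commute (ρ f) q := by
  let G1 : C(X, ℝ) := ⟨fun x => (f x).re, by fun_prop⟩
  let G2 : C(X, ℝ) := ⟨fun x => (f x).im, by fun_prop⟩
  let f1 : C(X, ℂ) := ⟨fun x => ((f x).re : ℂ), by fun_prop⟩
  let f2 : C(X, ℂ) := ⟨fun x => ((f x).im : ℂ), by fun_prop⟩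
  have h : f = f1 + Complex.I • f2 := by
    ext x
    show f x = ((f x).re : ℂ) + Complex.I * ((f x).im : ℂ)
    rw [mul_comm, Complex.re_add_im]
  rw [h, map_add, map_smul]
  refine (real_comm hK ρ hρ G1 (fun x => ?_) f1 (fun x => rfl) q hq).add_left
    ((real_comm hK ρ hρ G2 (fun x => ?_) f2 (fun x => rfl) q hq).smul_left _)
  · exact (Complex.abs_re_le_norm _).trans (hf x)
  · exact (Complex.abs_im_le_norm _).trans (hf x)
end comm


theorem fourier_root (θ : ℝ) (hθ : Irrational θ) (n : ℕ) (hn : 0 < n) :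
    (fourier 1 (((-θ : ℝ)) : AddCircle (1 : ℝ)) : ℂ) ^ n ≠ 1 := by
  intro h
  rw [fourier_coe_apply, ← Complex.exp_nat_mul, Complex.exp_eq_one_iff] at h
  obtain ⟨k, hk⟩ := h
  have hpi : (2 * (Real.pi : ℂ) * Complex.I) ≠ 0 := Complex.two_pi_I_ne_zero
  have h2 : (2 * (Real.pi : ℂ) * Complex.I) * (-(n * θ)) = (2 * (Real.pi : ℂ) * Complex.I) * k := by
    rw [mul_comm _ (k : ℂ), ← hk]; push_cast; ring
  have h3 := mul_left_cancel₀ hpi h2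
  have h4 : -((n : ℝ) * θ) = k := by exact_mod_cast h3
  apply hθ
  refine ⟨-(k : ℚ) / n, ?_⟩
  push_cast
  have : (n : ℝ) ≠ 0 := by positivity
  rw [← h4]
  field_simp


theorem core_main {A : Type*} [NormedRing A] [NormedAlgebra ℂ A]
    {B : Type*} [NormedRing B] [NormedAlgebra ℂ B] [CompleteSpace B]
    (S : Subalgebra ℂ A) (U U' : A) (MA : C(AddCircle (1 : ℝ), ℂ) →ₐ[ℂ] A)
    (hUS : U ∈ S) (hUS' : U' ∈ S) (hMS : ∀ f, MA f ∈ S) (hMn : ∀ f, ‖MA f‖ ≤ ‖f‖)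
    (hUn : ‖U‖ ≤ 1) (hUn' : ‖U'‖ ≤ 1) (hUU' : U * U' = 1) (hU'U : U' * U = 1)
    (θ : ℝ) (hθ : Irrational θ)
    (hcommU : U * MA (fourier 1) =
      (fourier 1 (((-θ : ℝ)) : AddCircle (1 : ℝ)) : ℂ) • (MA (fourier 1) * U))
    (hK : ∀ q r : B, IsHP q → IsHP r → q * r = r * q)
    (Bs : ℕ → Set B) (hmono : Monotone Bs) (hdense : Dense (⋃ j, Bs j))
    (hMU : ∀ j, ∃ (I : Type) (_ : Fintype I) (_ : DecidableEq I), Nonempty (MU (Bs j) I))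
    (φ : S →ₐ[ℂ] B) (hφ : ∀ a, ‖φ a‖ ≤ ‖a‖) : False := by
  let ρ : C(AddCircle (1 : ℝ), ℂ) →ₐ[ℂ] B := φ.comp (MA.codRestrict S hMS)
  have hρ : ∀ f, ‖ρ f‖ ≤ ‖f‖ := fun f => (hφ (MA.codRestrict S hMS f)).trans (hMn f)
  have hff : (fourier (-1) : C(AddCircle (1 : ℝ), ℂ)) * fourier 1 = 1 := by
    ext x
    rw [ContinuousMap.mul_apply, ← fourier_add]
    simp
  have hfn : ∀ k : ℤ, ‖(fourier k : C(AddCircle (1 : ℝ), ℂ))‖ ≤ 1 := by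
    intro k
    haveI : Fact ((0 : ℝ) < 1) := ⟨one_pos⟩
    exact (fourier_norm k).le
  refine abstract_main hK Bs hmono hdense hMU
    (u := φ ⟨U, hUS⟩) (u' := φ ⟨U', hUS'⟩) (v := ρ (fourier 1)) (v' := ρ (fourier (-1)))
    ?_ ?_ ((hφ _).trans hUn) ((hφ _).trans hUn') ?_ ((hρ _).trans (hfn _)) ?_
    (fourier 1 (((-θ : ℝ)) : AddCircle (1 : ℝ)) : ℂ) (fourier_root θ hθ) ?_
  · rw [← map_mul, ← map_one φ]; congr 1; exact Subtype.ext hUU'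
  · rw [← map_mul, ← map_one φ]; congr 1; exact Subtype.ext hU'U
  · rw [← map_mul, hff, map_one]
  · intro q hq
    refine unit_comm hK ρ hρ (fourier 1) (fun x => ?_) q hq
    exact (ContinuousMap.norm_coe_le_norm _ x).trans (hfn 1)
  · show φ _ * φ _ = _ • (φ _ * φ _)
    rw [← map_mul, ← map_mul, ← map_smul]
    congr 1
    exact Subtype.ext hcommU

end Helpers

/-- For `p ∈ (1,∞) \ {2}` and irrational `θ`, the `L^p`-irrational rotation algebra
`A_θ^p = C(𝕋) ⋊^p_{r_θ} ℤ` — realized concretely on `ℓ^p(𝕋 × ℤ)` as the smallest closed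
subalgebra containing the bilateral shifts `U, U'` and the multiplication operators `M f`
for continuous `f : 𝕋 → ℂ` — admits no unital contractive homomorphism into any unital
spatial AF `L^p`-operator algebra `B`, i.e. any unital complex Banach algebra `B` which
(i) embeds unitally and isometrically into `B(L^p(μ))` for some measure space `(Ω, μ)` and
(ii) is the closure of an increasing union of closed subalgebras, each isometrically
isomorphic to a finite direct sum of spatial matrix algebras `M_N^p = B(ℓ^p(Fin N))` with
the maximum norm. -/
theorem irrational_rotation_algebra_not_spatial_AF_embeddable
    (p : ℝ≥0∞) [Fact (1 ≤ p)] (hp_one : 1 < p) (hp_top : p ≠ ∞) (hp_two : p ≠ 2)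
    (θ : ℝ) (hθ : Irrational θ)
    (U U' : lp (fun _ : AddCircle (1 : ℝ) × ℤ => ℂ) p →L[ℂ]
      lp (fun _ : AddCircle (1 : ℝ) × ℤ => ℂ) p)
    (M : C(AddCircle (1 : ℝ), ℂ) → (lp (fun _ : AddCircle (1 : ℝ) × ℤ => ℂ) p →L[ℂ]
      lp (fun _ : AddCircle (1 : ℝ) × ℤ => ℂ) p))
    (hU : ∀ (ξ : lp (fun _ : AddCircle (1 : ℝ) × ℤ => ℂ) p) (x : AddCircle (1 : ℝ)) (n : ℤ),
      U ξ (x, n) = ξ (x, n - 1))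
    (hU' : ∀ (ξ : lp (fun _ : AddCircle (1 : ℝ) × ℤ => ℂ) p) (x : AddCircle (1 : ℝ)) (n : ℤ),
      U' ξ (x, n) = ξ (x, n + 1))
    (hM : ∀ (f : C(AddCircle (1 : ℝ), ℂ)) (ξ : lp (fun _ : AddCircle (1 : ℝ) × ℤ => ℂ) p)
      (x : AddCircle (1 : ℝ)) (n : ℤ),
      M f ξ (x, n) = f (x + (((n : ℝ) * θ : ℝ) : AddCircle (1 : ℝ))) * ξ (x, n))
    (B : Type*) [NormedRing B] [NormedAlgebra ℂ B] [CompleteSpace B]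
    (hrep : ∃ (Ω : Type) (_ : MeasurableSpace Ω) (μ : MeasureTheory.Measure Ω)
      (ψ : B →ₐ[ℂ] (MeasureTheory.Lp ℂ p μ →L[ℂ] MeasureTheory.Lp ℂ p μ)),
      ∀ b : B, ‖ψ b‖ = ‖b‖)
    (hAF : ∃ Bseq : ℕ → Subalgebra ℂ B, Monotone Bseq ∧
      (∀ j, IsClosed (Bseq j : Set B)) ∧
      Dense (⋃ j, (Bseq j : Set B)) ∧
      ∀ j, ∃ (Mj : ℕ) (_ : 0 < Mj) (N : Fin Mj → ℕ) (_ : ∀ i, 0 < N i)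
        (e : Bseq j ≃ₐ[ℂ] (∀ i : Fin Mj,
          (lp (fun _ : Fin (N i) => ℂ) p →L[ℂ] lp (fun _ : Fin (N i) => ℂ) p))),
        ∀ b : Bseq j, ‖e b‖ = ‖b‖) :
    ¬ ∃ φ : (Algebra.adjoin ℂ ({U, U'} ∪ Set.range M)).topologicalClosure →ₐ[ℂ] B,
      ∀ a, ‖φ a‖ ≤ ‖a‖ := by
  classical
  rintro ⟨φ, hφ⟩
  obtain ⟨Ω, _, μ, ψ, hψ⟩ := hrep
  obtain ⟨Bseq, hmono, -, hdense, hfin⟩ := hAF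
  have hψi : Function.Injective ψ := by
    intro a b h
    have := hψ (a - b)
    rw [map_sub, h, sub_self, norm_zero] at this
    exact sub_eq_zero.1 (norm_eq_zero.1 this.symm)
  have hψI : ∀ q : B, IsHP q → IsHP (ψ q) := by
    intro q hq
    refine ⟨by rw [← map_mul, hq.1], fun z hz => ?_⟩
    have : 1 - ψ q + z • ψ q = ψ (1 - q + z • q) := by simp
    rw [this, hψ]
    exact hq.2 z hz
  have hK : ∀ q r : B, IsHP q → IsHP r → q * r = r * q := by
    intro q r hq hr
    apply hψi
    rw [map_mul, map_mul]
    exact aux_comm hp_top hp_two (hψI q hq) (hψI r hr)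
  let S := (Algebra.adjoin ℂ ({U, U'} ∪ Set.range M)).topologicalClosure
  have hsub : ∀ x, x ∈ ({U, U'} ∪ Set.range M) → x ∈ S := fun x hx =>
    Subalgebra.le_topologicalClosure _ (Algebra.subset_adjoin hx)
  have hUS : U ∈ S := hsub _ (by simp)
  have hUS' : U' ∈ S := hsub _ (by simp)
  have hMS : ∀ f, M f ∈ S := fun f => hsub _ (by simp)
  let MA : C(AddCircle (1 : ℝ), ℂ) →ₐ[ℂ] (lp (fun _ : AddCircle (1 : ℝ) × ℤ => ℂ) p →L[ℂ]
      lp (fun _ : AddCircle (1 : ℝ) × ℤ => ℂ) p) :=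
    { toFun := M
      map_one' := by
        ext ξ ⟨x, n⟩
        rw [hM]; simp
      map_mul' := fun f g => by
        ext ξ ⟨x, n⟩
        rw [hM, mul_apply_eq_comp, hM, hM, ContinuousMap.mul_apply, mul_assoc]
      map_zero' := by
        ext ξ ⟨x, n⟩
        rw [hM]; simp
      map_add' := fun f g => by
        ext ξ ⟨x, n⟩
        have h1 : (M f + M g) ξ (x, n) = M f ξ (x, n) + M g ξ (x, n) := rfl
        refine (hM _ _ _ _).trans (Eq.trans ?_ h1.symm)
        rw [hM, hM, ← add_mul]; rfl
      commutes' := fun c => by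
        ext ξ ⟨x, n⟩
        rw [hM, Algebra.algebraMap_eq_smul_one, Algebra.algebraMap_eq_smul_one]
        simp }
  have hMn : ∀ f, ‖MA f‖ ≤ ‖f‖ := by
    intro f
    show ‖M f‖ ≤ ‖f‖
    refine lp_opnorm_le hp_top _ id Function.injective_id _ (norm_nonneg _) ?_
    rintro ξ ⟨x, n⟩
    rw [hM, norm_mul]
    gcongr
    · exact f.norm_coe_le_norm _
    · exact le_rfl
  have hUn : ‖U‖ ≤ 1 := by
    refine lp_opnorm_le hp_top _ (fun a => (a.1, a.2 - 1)) ?_ 1 zero_le_one ?_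
    · rintro ⟨x, n⟩ ⟨y, m⟩ h
      simpa using h
    · rintro ξ ⟨x, n⟩
      rw [hU, one_mul]
  have hUn' : ‖U'‖ ≤ 1 := by
    refine lp_opnorm_le hp_top _ (fun a => (a.1, a.2 + 1)) ?_ 1 zero_le_one ?_
    · rintro ⟨x, n⟩ ⟨y, m⟩ h
      simpa using h
    · rintro ξ ⟨x, n⟩
      rw [hU', one_mul]
  have hUU' : U * U' = 1 := by
    ext ξ ⟨x, n⟩
    rw [mul_apply_eq_comp, hU, hU', sub_add_cancel]; rfl
  have hU'U : U' * U = 1 := by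
    ext ξ ⟨x, n⟩
    rw [mul_apply_eq_comp, hU', hU, add_sub_cancel_right]; rfl
  have hcommU : U * M (fourier 1) =
      (fourier 1 (((-θ : ℝ)) : AddCircle (1 : ℝ)) : ℂ) • (M (fourier 1) * U) := by
    ext ξ ⟨x, n⟩
    rw [mul_apply_eq_comp, hU, hM, smul_apply, lp.coeFn_smul,
      Pi.smul_apply, mul_apply_eq_comp, hM, hU, smul_eq_mul, ← mul_assoc]
    congr 1
    rw [fourier_one, fourier_one, fourier_one, ← Circle.coe_mul, ← AddCircle.toCircle_add]
    congr 2
    rw [add_left_comm, ← AddCircle.coe_add]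
    congr 2
    push_cast; ring
  refine core_main S U U' MA hUS hUS' hMS hMn hUn hUn' hUU' hU'U θ hθ hcommU hK
    (fun j => (Bseq j : Set B)) (fun i j h => hmono h) hdense ?_ φ hφ
  intro j
  obtain ⟨Mj, hMj, N, hN, e, he⟩ := hfin j
  exact ⟨_, inferInstance, inferInstance, mkMU' (Bseq j) hp_top hMj hN e he⟩
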